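/- Let n ≥ 4 be an integer and let T ∈ Mₙ(ℂ). The following are equivalent: (a) T has property (CN); (b) T has property (CR); (c) either there exist λ, μ ∈ ℂ and a unitary V ∈ Mₙ(ℂ) such that T = λ·1 + μ·V, or there exist λ, μ ∈ ℂ and a Hermitian L ∈ Mₙ(ℂ) (L = Lᴴ) such that T = λ·1 + μ·L. -/

import Mathlib

open Matrix

noncomputable def opN {n : ℕ} (M : Matrix (Fin n) (Fin n) ℂ) : ℝ :=
  ‖Matrix.toEuclideanCLM (𝕜 := ℂ) M‖

def HasCN {n : ℕ} (T : Matrix (Fin n) (Fin n) ℂ) : Prop :=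
  ∀ P : Matrix (Fin n) (Fin n) ℂ, P * P = P → Pᴴ = P →
    opN (P * T * (1 - P)) = opN ((1 - P) * T * P)

def HasCR {n : ℕ} (T : Matrix (Fin n) (Fin n) ℂ) : Prop :=
  ∀ P : Matrix (Fin n) (Fin n) ℂ, P * P = P → Pᴴ = P →
    (P * T * (1 - P)).rank = ((1 - P) * T * P).rank

section Corners

open scoped ComplexOrder

section Norms

open scoped Matrix.Norms.L2Operator

lemma opN_eq_norm {n : ℕ} (M : Matrix (Fin n) (Fin n) ℂ) : opN M = ‖M‖ := rfl

lemma opN_smul {n : ℕ} (c : ℂ) (M : Matrix (Fin n) (Fin n) ℂ) : opN (c • M) = ‖c‖ * opN M := by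
  simp only [opN_eq_norm, norm_smul]

lemma opN_eq_zero_iff {n : ℕ} {M : Matrix (Fin n) (Fin n) ℂ} : opN M = 0 ↔ M = 0 := by
  rw [opN_eq_norm, norm_eq_zero]

lemma opN_nonneg {n : ℕ} (M : Matrix (Fin n) (Fin n) ℂ) : 0 ≤ opN M := norm_nonneg _

lemma opN_conjTranspose {n : ℕ} (M : Matrix (Fin n) (Fin n) ℂ) : opN Mᴴ = opN M :=
  l2_opNorm_conjTranspose M

lemma opN_conjTranspose_mul_self {n : ℕ} (M : Matrix (Fin n) (Fin n) ℂ) :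
    opN (Mᴴ * M) = opN M ^ 2 := by
  rw [sq]
  exact l2_opNorm_conjTranspose_mul_self M

lemma opN_mul_conjTranspose_self {n : ℕ} (M : Matrix (Fin n) (Fin n) ℂ) :
    opN (M * Mᴴ) = opN M ^ 2 := by
  simpa [opN_conjTranspose] using opN_conjTranspose_mul_self Mᴴ

lemma opN_unitary_conj {n : ℕ} (U : unitaryGroup (Fin n) ℂ) (M : Matrix (Fin n) (Fin n) ℂ) :
    opN ((U : Matrix (Fin n) (Fin n) ℂ) * M * star (U : Matrix (Fin n) (Fin n) ℂ)) = opN M := by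
  simp only [opN_eq_norm]
  rw [CStarRing.norm_mul_mem_unitary _ (Unitary.star_mem U.2), CStarRing.norm_mem_unitary_mul _ U.2]

lemma Matrix.IsHermitian.opN_eq_norm_eigenvalues {n : ℕ} {A : Matrix (Fin n) (Fin n) ℂ}
    (hA : A.IsHermitian) : opN A = ‖hA.eigenvalues‖ := by
  conv_lhs => rw [hA.spectral_theorem, Unitary.conjStarAlgAut_apply]
  rw [opN_unitary_conj, opN_eq_norm, l2_opNorm_diagonal]
  simp [Pi.norm_def]

end Norms

lemma card_ne_zero_le_one_iff_norm_eq_sum {ι : Type*} [Fintype ι] {f : ι → ℝ} (hf : ∀ i, 0 ≤ f i) :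
    Fintype.card {i // f i ≠ 0} ≤ 1 ↔ ‖f‖ = ∑ i, f i := by
  classical
  rw [Fintype.card_le_one_iff]
  constructor
  · intro h
    apply le_antisymm
    · refine (pi_norm_le_iff_of_nonneg (Finset.sum_nonneg fun i _ => hf i)).2 fun i => ?_
      rw [Real.norm_of_nonneg (hf i)]
      exact Finset.single_le_sum (fun j _ => hf j) (Finset.mem_univ i)
    · by_cases h0 : ∃ i, f i ≠ 0
      · obtain ⟨i, hi⟩ := h0
        rw [Finset.sum_eq_single i]
        · exact (le_abs_self _).trans (norm_le_pi_norm f i)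
        · intro j _ hj
          by_contra hj0
          exact hj (congrArg Subtype.val (h ⟨j, hj0⟩ ⟨i, hi⟩))
        · simp
      · push Not at h0
        simp [h0]
  · rintro h ⟨i, hi⟩ ⟨j, hj⟩
    have : Nonempty ι := ⟨i⟩
    obtain ⟨k, hk⟩ := Finite.exists_max f
    have hle : ∑ i, f i ≤ f k := by
      rw [← h]
      refine (pi_norm_le_iff_of_nonneg (hf k)).2 fun i => ?_
      rw [Real.norm_of_nonneg (hf i)]
      exact hk i
    have key : ∀ l, f l ≠ 0 → l = k := by
      intro l hl
      by_contra hlk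
      have h1 := Finset.sum_le_sum_of_subset_of_nonneg (Finset.subset_univ {l, k})
        (fun i _ _ => hf i)
      rw [Finset.sum_pair hlk] at h1
      exact hl (le_antisymm (by linarith) (hf l))
    exact Subtype.ext ((key i hi).trans (key j hj).symm)

lemma Matrix.PosSemidef.rank_le_one_iff {n : ℕ} {A : Matrix (Fin n) (Fin n) ℂ}
    (hA : A.PosSemidef) : A.rank ≤ 1 ↔ (opN A : ℂ) = A.trace := by
  rw [hA.isHermitian.rank_eq_card_non_zero_eigs,
    card_ne_zero_le_one_iff_norm_eq_sum hA.eigenvalues_nonneg,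
    ← hA.isHermitian.opN_eq_norm_eigenvalues, hA.isHermitian.trace_eq_sum_eigenvalues, ← Complex.ofReal_inj, Complex.ofReal_sum]
  rfl

/-- For a normal matrix with equal corner norms, both corners have the same Hilbert–Schmidt norm,
and a matrix has rank at most one exactly when its operator and Hilbert–Schmidt norms agree. -/
lemma rank_corner_le_one_iff_of_normal {n : ℕ} {T P : Matrix (Fin n) (Fin n) ℂ}
    (hT : Tᴴ * T = T * Tᴴ) (hP : P * P = P) (hP' : Pᴴ = P)
    (h : opN (P * T * (1 - P)) = opN ((1 - P) * T * P)) :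
    (P * T * (1 - P)).rank ≤ 1 ↔ ((1 - P) * T * P).rank ≤ 1 := by
  set X := P * T * (1 - P) with hX
  set Y := (1 - P) * T * P with hY
  have hQ : (1 - P) * (1 - P) = 1 - P := by noncomm_ring [hP]
  have tr : (X * Xᴴ).trace = (Yᴴ * Y).trace := by
    have e1 : (X * Xᴴ).trace = (P * (T * Tᴴ)).trace - (P * T * P * Tᴴ).trace := by
      rw [← trace_sub]
      have : X * Xᴴ = (P * (T * ((1 - P) * (1 - P)) * Tᴴ)) * P := by
        simp only [hX, conjTranspose_mul, conjTranspose_sub, conjTranspose_one, hP', mul_assoc]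
      rw [this, hQ, trace_mul_comm, ← mul_assoc, hP]
      congr 1; noncomm_ring
    have e2 : (Yᴴ * Y).trace = (P * (Tᴴ * T)).trace - (P * Tᴴ * P * T).trace := by
      rw [← trace_sub]
      have : Yᴴ * Y = (P * (Tᴴ * ((1 - P) * (1 - P)) * T)) * P := by
        simp only [hY, conjTranspose_mul, conjTranspose_sub, conjTranspose_one, hP', mul_assoc]
      rw [this, hQ, trace_mul_comm, ← mul_assoc, hP]
      congr 1; noncomm_ring
    have e3 : (P * T * P * Tᴴ).trace = (P * Tᴴ * P * T).trace := by
      rw [mul_assoc, trace_mul_comm, ← mul_assoc]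
    rw [e1, e2, e3, hT]
  rw [← rank_self_mul_conjTranspose X, ← rank_conjTranspose_mul_self Y,
    (posSemidef_self_mul_conjTranspose X).rank_le_one_iff,
    (posSemidef_conjTranspose_mul_self Y).rank_le_one_iff,
    opN_mul_conjTranspose_self, opN_conjTranspose_mul_self, h, tr]

lemma Matrix.IsHermitian.exists_unitary_conj_of_charpoly_eq {n : ℕ}
    {A B : Matrix (Fin n) (Fin n) ℂ} (hA : A.IsHermitian) (hB : B.IsHermitian)
    (h : A.charpoly = B.charpoly) :
    ∃ U : unitaryGroup (Fin n) ℂ,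
      A = (U : Matrix (Fin n) (Fin n) ℂ) * B * star (U : Matrix (Fin n) (Fin n) ℂ) := by
  have he := (hA.eigenvalues_eq_eigenvalues_iff hB).2 h
  refine ⟨hA.eigenvectorUnitary * star hB.eigenvectorUnitary, ?_⟩
  have h1 := hA.spectral_theorem
  rw [he, ← hB.conjStarAlgAut_star_eigenvectorUnitary, ← Unitary.conjStarAlgAut_mul_apply] at h1
  rw [Unitary.conjStarAlgAut_apply] at h1
  exact h1

lemma rank_unitary_conj {n : ℕ} (U : unitaryGroup (Fin n) ℂ) (M : Matrix (Fin n) (Fin n) ℂ) :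
    ((U : Matrix (Fin n) (Fin n) ℂ) * M * star (U : Matrix (Fin n) (Fin n) ℂ)).rank = M.rank := by
  have hU : IsUnit (U : Matrix (Fin n) (Fin n) ℂ) := (Unitary.toUnits U).isUnit
  rw [rank_mul_eq_left_of_isUnit_det _ _ ((isUnit_iff_isUnit_det _).1 hU.star),
    rank_mul_eq_right_of_isUnit_det _ _ ((isUnit_iff_isUnit_det _).1 hU)]

/-- The matrix `N = (1 - P) + P V P` satisfies `N Nᴴ = 1 - X Xᴴ` and `Nᴴ N = 1 - Yᴴ Y`, where `X`
and `Y` are the off-diagonal corners of the unitary `V`. -/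
lemma exists_unitary_conj_corner {n : ℕ} {V P : Matrix (Fin n) (Fin n) ℂ}
    (hV : Vᴴ * V = 1) (hP : P * P = P) (hP' : Pᴴ = P) :
    ∃ U : unitaryGroup (Fin n) ℂ,
      (P * V * (1 - P)) * (P * V * (1 - P))ᴴ =
        (U : Matrix (Fin n) (Fin n) ℂ) * (((1 - P) * V * P)ᴴ * ((1 - P) * V * P)) *
          star (U : Matrix (Fin n) (Fin n) ℂ) := by
  have hV' : V * Vᴴ = 1 := mul_eq_one_comm.1 hV
  set N := (1 - P) + P * V * P with hN
  have hQ : (1 - P) * (1 - P) = 1 - P := by noncomm_ring [hP]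
  have hPQ : P * (1 - P) = 0 := by rw [mul_sub, hP, mul_one, sub_self]
  have hQP : (1 - P) * P = 0 := by rw [sub_mul, hP, one_mul, sub_self]
  have hNH : Nᴴ = (1 - P) + P * Vᴴ * P := by
    simp only [hN, conjTranspose_add, conjTranspose_mul, conjTranspose_sub, conjTranspose_one, hP',
      mul_assoc]
  have key : ∀ W Z : Matrix (Fin n) (Fin n) ℂ, W * Z = 1 →
      (P * W * (1 - P)) * ((1 - P) * Z * P) =
        1 - ((1 - P) + P * W * P) * ((1 - P) + P * Z * P) := by
    intro W Z hWZ
    have e1 : (P * W * (1 - P)) * ((1 - P) * Z * P) = P * (W * Z) * P - P * W * P * Z * P := by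
      calc _ = P * W * ((1 - P) * (1 - P)) * Z * P := by noncomm_ring
        _ = _ := by rw [hQ]; noncomm_ring
    have e2 : ((1 - P) + P * W * P) * ((1 - P) + P * Z * P) = (1 - P) + P * W * P * Z * P := by
      calc _ = (1 - P) * (1 - P) + ((1 - P) * P) * Z * P + P * W * (P * (1 - P))
              + P * W * (P * P) * Z * P := by noncomm_ring
        _ = _ := by rw [hQ, hPQ, hQP, hP]; noncomm_ring
    rw [e1, e2, hWZ, mul_one, hP]
    noncomm_ring
  have hXH : (P * V * (1 - P))ᴴ = (1 - P) * Vᴴ * P := by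
    simp only [conjTranspose_mul, conjTranspose_sub, conjTranspose_one, hP', mul_assoc]
  have hYH : ((1 - P) * V * P)ᴴ = P * Vᴴ * (1 - P) := by
    simp only [conjTranspose_mul, conjTranspose_sub, conjTranspose_one, hP', mul_assoc]
  obtain ⟨U, hU⟩ := (isHermitian_mul_conjTranspose_self N).exists_unitary_conj_of_charpoly_eq
    (isHermitian_conjTranspose_mul_self N) (charpoly_mul_comm _ _)
  refine ⟨U, ?_⟩
  rw [hXH, hYH, key _ _ hV', key _ _ hV, ← hNH, ← hN, mul_sub, sub_mul, ← hU, mul_one,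
    Unitary.mul_star_self_of_mem U.2]

/-- The matrices of the form `λ + μ V` with `V` unitary or `λ + μ L` with `L` Hermitian. -/
def IsAffineUnitaryOrHermitian {n : ℕ} (T : Matrix (Fin n) (Fin n) ℂ) : Prop :=
  (∃ (fl mu : ℂ) (V : Matrix (Fin n) (Fin n) ℂ), Vᴴ * V = 1 ∧ T = fl • 1 + mu • V) ∨
    (∃ (fl mu : ℂ) (L : Matrix (Fin n) (Fin n) ℂ), Lᴴ = L ∧ T = fl • 1 + mu • L)

lemma corner_smul_one_add_smul {n : ℕ} {A B : Matrix (Fin n) (Fin n) ℂ} (hAB : A * B = 0)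
    (a b : ℂ) (S : Matrix (Fin n) (Fin n) ℂ) : A * (a • 1 + b • S) * B = b • (A * S * B) := by
  simp [mul_add, add_mul, hAB]

lemma rank_smul_congr {n : ℕ} (c : ℂ) {A B : Matrix (Fin n) (Fin n) ℂ} (h : A.rank = B.rank) :
    (c • A).rank = (c • B).rank := by
  rcases eq_or_ne c 0 with rfl | hc
  · simp
  · rw [rank_smul_of_mem_nonZeroDivisors _ (mem_nonZeroDivisors_of_ne_zero hc),
      rank_smul_of_mem_nonZeroDivisors _ (mem_nonZeroDivisors_of_ne_zero hc), h]

lemma IsAffineUnitaryOrHermitian.corners {n : ℕ} {T : Matrix (Fin n) (Fin n) ℂ}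
    (h : IsAffineUnitaryOrHermitian T) : HasCN T ∧ HasCR T := by
  suffices ∀ P : Matrix (Fin n) (Fin n) ℂ, P * P = P → Pᴴ = P →
      opN (P * T * (1 - P)) = opN ((1 - P) * T * P) ∧
        (P * T * (1 - P)).rank = ((1 - P) * T * P).rank from
    ⟨fun P h1 h2 => (this P h1 h2).1, fun P h1 h2 => (this P h1 h2).2⟩
  intro P hP hP'
  have hPQ : P * (1 - P) = 0 := by rw [mul_sub, hP, mul_one, sub_self]
  have hQP : (1 - P) * P = 0 := by rw [sub_mul, hP, one_mul, sub_self]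
  obtain ⟨a, b, V, hV, rfl⟩ | ⟨a, b, L, hL, rfl⟩ := h
  · rw [corner_smul_one_add_smul hPQ, corner_smul_one_add_smul hQP, opN_smul, opN_smul]
    obtain ⟨U, hU⟩ := exists_unitary_conj_corner hV hP hP'
    constructor
    · refine congrArg (‖b‖ * ·) ?_
      rw [← sq_eq_sq₀ (opN_nonneg _) (opN_nonneg _), ← opN_mul_conjTranspose_self, hU,
        opN_unitary_conj, opN_conjTranspose_mul_self]
    · apply rank_smul_congr
      rw [← rank_self_mul_conjTranspose, hU, rank_unitary_conj, rank_conjTranspose_mul_self]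
  · rw [corner_smul_one_add_smul hPQ, corner_smul_one_add_smul hQP, opN_smul, opN_smul]
    have hX : P * L * (1 - P) = ((1 - P) * L * P)ᴴ := by
      simp only [conjTranspose_mul, conjTranspose_sub, conjTranspose_one, hP', hL, mul_assoc]
    constructor
    · rw [hX, opN_conjTranspose]
    · apply rank_smul_congr
      rw [hX, rank_conjTranspose]

lemma isAffineUnitaryOrHermitian_of_line {n : ℕ} {T : Matrix (Fin n) (Fin n) ℂ} {w c : ℂ}
    (hw : w ≠ 0) (h : w • T - star w • Tᴴ = c • 1) : IsAffineUnitaryOrHermitian T := by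
  refine Or.inr ⟨w⁻¹ * (c / 2), w⁻¹, (1 / 2 : ℂ) • (w • T + star w • Tᴴ), ?_, ?_⟩
  · simp [conjTranspose_smul, conjTranspose_add, add_comm]
  · rw [mul_smul, ← smul_add, eq_inv_smul_iff₀ hw, div_eq_mul_one_div, mul_comm c, mul_smul, ← h]
    module

lemma isAffineUnitaryOrHermitian_of_circle {n : ℕ} {T : Matrix (Fin n) (Fin n) ℂ} {b d : ℂ}
    (h : Tᴴ * T + b • Tᴴ + star b • T = d • 1) : IsAffineUnitaryOrHermitian T := by
  set B := T + b • (1 : Matrix (Fin n) (Fin n) ℂ) with hB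
  obtain ⟨r, hr⟩ : ∃ r, r = d + star b * b := ⟨_, rfl⟩
  have hBB : Bᴴ * B = r • 1 := by
    rw [hr, add_smul, ← h, hB]
    simp only [conjTranspose_add, conjTranspose_smul, conjTranspose_one, mul_add, add_mul,
      smul_mul_assoc, mul_smul_comm, one_mul, mul_one, mul_smul]
    module
  have hT : T = -b • 1 + B := by rw [hB]; module
  rcases isEmpty_or_nonempty (Fin n) with hn | ⟨⟨i⟩⟩
  · exact Or.inr ⟨0, 0, 0, Subsingleton.elim _ _, Subsingleton.elim _ _⟩
  have hr0 : 0 ≤ r := by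
    have h1 := congrFun (congrFun hBB i) i
    simp only [mul_apply, conjTranspose_apply, Matrix.smul_apply, one_apply_eq, smul_eq_mul, mul_one] at h1
    rw [← h1]
    exact Finset.sum_nonneg fun j _ => star_mul_self_nonneg _
  obtain ⟨s, hs0, rfl⟩ : ∃ s : ℝ, 0 ≤ s ∧ r = (s : ℂ) := by
    obtain ⟨s, hs, rfl⟩ := RCLike.nonneg_iff_exists_ofReal.1 hr0
    exact ⟨s, hs, rfl⟩
  rcases hs0.eq_or_lt with rfl | hs
  · refine Or.inr ⟨-b, 0, 0, by simp, ?_⟩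
    have : B = 0 := conjTranspose_mul_self_eq_zero.1 (by rw [hBB]; simp)
    rw [hT, this]; simp
  · have hsq : (√s : ℂ) ≠ 0 := by exact_mod_cast (Real.sqrt_pos.2 hs).ne'
    refine Or.inl ⟨-b, (√s : ℂ), (√s : ℂ)⁻¹ • B, ?_, ?_⟩
    · rw [conjTranspose_smul, smul_mul_smul_comm, hBB, smul_smul]
      have h2 : (√s : ℂ) * √s = s := by exact_mod_cast Real.mul_self_sqrt hs.le
      have h3 : star ((√s : ℂ)⁻¹) = (√s : ℂ)⁻¹ := by simp
      rw [h3, ← h2]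
      rw [show (√s : ℂ)⁻¹ * (√s : ℂ)⁻¹ * (√s * √s) = 1 by field_simp, one_smul]
    · rw [smul_inv_smul₀ hsq, ← hT]

lemma isAffineUnitaryOrHermitian_of_relation {n : ℕ} {T : Matrix (Fin n) (Fin n) ℂ} {a b c d : ℂ}
    (hab : a ≠ 0 ∨ b ≠ 0) (h : a • (Tᴴ * T) + b • Tᴴ = c • T + d • 1) :
    IsAffineUnitaryOrHermitian T := by
  by_cases ha : a = 0
  · have hb : b ≠ 0 := by simpa [ha] using hab
    have h1 : Tᴴ = (b⁻¹ * c) • T + (b⁻¹ * d) • 1 := by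
      rw [mul_smul, mul_smul, ← smul_add, ← h, ha, zero_smul, zero_add, inv_smul_smul₀ hb]
    generalize b⁻¹ * c = g at h1
    generalize b⁻¹ * d = e at h1
    have h2 : T = star g • Tᴴ + star e • 1 := by
      have := congrArg conjTranspose h1
      simpa [conjTranspose_smul, conjTranspose_add] using this
    by_cases hg : g = 1
    · refine isAffineUnitaryOrHermitian_of_line (w := 1) (c := -e) one_ne_zero ?_
      rw [h1, hg]; simp
    · refine isAffineUnitaryOrHermitian_of_line (w := Complex.I * (1 - g))
        (c := Complex.I * (e + star e)) (mul_ne_zero Complex.I_ne_zero (sub_ne_zero.2 (Ne.symm hg))) ?_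
      have h3 : (1 - g) • T + (1 - star g) • Tᴴ = (e + star e) • 1 := by
        calc _ = (T - star g • Tᴴ) + (Tᴴ - g • T) := by module
          _ = _ := by
            rw [sub_eq_of_eq_add' h2, sub_eq_of_eq_add' h1]; module
      rw [mul_smul Complex.I (e + star e), ← h3]
      simp only [star_mul', star_sub, star_one, Complex.star_def, Complex.conj_I]
      module
  · have h1 : Tᴴ * T = (a⁻¹ * c) • T + (a⁻¹ * d) • 1 - (a⁻¹ * b) • Tᴴ := by
      rw [mul_smul, mul_smul, mul_smul, ← smul_add, ← smul_sub, ← h, add_sub_cancel_right,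
        inv_smul_smul₀ ha]
    generalize a⁻¹ * c = g at h1
    generalize a⁻¹ * d = e at h1
    generalize a⁻¹ * b = f at h1
    have h2 : Tᴴ * T = star g • Tᴴ + star e • 1 - star f • T := by
      have := congrArg conjTranspose h1
      simpa [conjTranspose_smul, conjTranspose_add, conjTranspose_sub] using this
    by_cases hw : g + star f = 0
    · refine isAffineUnitaryOrHermitian_of_circle (b := f) (d := e) ?_
      rw [h1, eq_neg_of_add_eq_zero_left hw]; module
    · refine isAffineUnitaryOrHermitian_of_line (w := g + star f) (c := star e - e) hw ?_
      rw [star_add, star_star]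
      have h3 := h1.symm.trans h2
      linear_combination (norm := module) h3

lemma rank_le_one_iff_exists_smul {n : ℕ} {M : Matrix (Fin n) (Fin n) ℂ} :
    M.rank ≤ 1 ↔ ∃ y : EuclideanSpace ℂ (Fin n), ∀ v, ∃ c : ℂ,
      c • y = toEuclideanCLM (𝕜 := ℂ) M v := by
  constructor
  · intro h
    rw [rank, finrank_le_one_iff] at h
    obtain ⟨⟨y, hy⟩, h⟩ := h
    refine ⟨WithLp.toLp 2 y, fun v => ?_⟩
    obtain ⟨c, hc⟩ := h ⟨M *ᵥ v.ofLp, ⟨v.ofLp, rfl⟩⟩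
    refine ⟨c, WithLp.ofLp_injective 2 ?_⟩
    simpa using congrArg Subtype.val hc
  · rintro ⟨y, h⟩
    rw [rank]
    refine (Submodule.finrank_mono (t := Submodule.span ℂ {y.ofLp}) ?_).trans
      ((finrank_span_le_card _).trans (by simp))
    rintro _ ⟨v, rfl⟩
    obtain ⟨c, hc⟩ := h (WithLp.toLp 2 v)
    exact Submodule.mem_span_singleton.2 ⟨c, by simpa using congrArg WithLp.ofLp hc⟩

lemma toEuclideanCLM_conjTranspose {n : ℕ} (T : Matrix (Fin n) (Fin n) ℂ) :
    toEuclideanCLM (𝕜 := ℂ) Tᴴ = ContinuousLinearMap.adjoint (toEuclideanCLM (𝕜 := ℂ) T) :=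
  map_star (toEuclideanCLM (𝕜 := ℂ)) T

lemma exists_projection_matrix {n : ℕ} (K : Submodule ℂ (EuclideanSpace ℂ (Fin n))) :
    ∃ P : Matrix (Fin n) (Fin n) ℂ, P * P = P ∧ Pᴴ = P ∧
      toEuclideanCLM (𝕜 := ℂ) P = K.starProjection := by
  obtain ⟨P, hP⟩ := (EquivLike.surjective (toEuclideanCLM (n := Fin n) (𝕜 := ℂ))) K.starProjection
  have hK : IsStarProjection K.starProjection := isStarProjection_starProjection
  refine ⟨P, (EquivLike.injective (toEuclideanCLM (n := Fin n) (𝕜 := ℂ))) ?_,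
    (EquivLike.injective (toEuclideanCLM (n := Fin n) (𝕜 := ℂ))) ?_, hP⟩
  · rw [map_mul, hP]
    exact hK.isIdempotentElem
  · rw [toEuclideanCLM_conjTranspose, hP]
    exact hK.isSelfAdjoint

lemma conjTranspose_corner {n : ℕ} {T P : Matrix (Fin n) (Fin n) ℂ} (hP : Pᴴ = P) :
    (P * T * (1 - P))ᴴ = (1 - P) * Tᴴ * P := by
  simp only [conjTranspose_mul, conjTranspose_sub, conjTranspose_one, hP, mul_assoc]

lemma toEuclideanCLM_corner_apply {n : ℕ} {T P : Matrix (Fin n) (Fin n) ℂ}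
    {K : Submodule ℂ (EuclideanSpace ℂ (Fin n))} (hPK : toEuclideanCLM (𝕜 := ℂ) P = K.starProjection)
    (v : EuclideanSpace ℂ (Fin n)) :
    toEuclideanCLM (𝕜 := ℂ) ((1 - P) * T * P) v =
      toEuclideanCLM (𝕜 := ℂ) T (K.starProjection v) -
        K.starProjection (toEuclideanCLM (𝕜 := ℂ) T (K.starProjection v)) := by
  simp [map_mul, map_sub, hPK]

/-- If every invariant subspace reduces `T`, eigenvectors of `T` are eigenvectors of `Tᴴ`. -/
lemma adjoint_apply_eigenvector {n : ℕ} {T : Matrix (Fin n) (Fin n) ℂ}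
    (hT : ∀ P : Matrix (Fin n) (Fin n) ℂ, P * P = P → Pᴴ = P →
      (1 - P) * T * P = 0 → P * T * (1 - P) = 0)
    {x : EuclideanSpace ℂ (Fin n)} {μ : ℂ} (hx : toEuclideanCLM (𝕜 := ℂ) T x = μ • x) :
    toEuclideanCLM (𝕜 := ℂ) Tᴴ x = star μ • x := by
  rcases eq_or_ne x 0 with rfl | hx0
  · simp
  obtain ⟨P, hP, hP', hPK⟩ := exists_projection_matrix (Submodule.span ℂ {x})
  have h1 : (1 - P) * T * P = 0 := by
    apply (EquivLike.injective (toEuclideanCLM (n := Fin n) (𝕜 := ℂ)))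
    ext1 v
    rw [toEuclideanCLM_corner_apply hPK]
    obtain ⟨c, hc⟩ := Submodule.mem_span_singleton.1
      (Submodule.starProjection_apply_mem (Submodule.span ℂ {x}) v)
    rw [← hc, map_smul, hx, Submodule.starProjection_eq_self_iff.2, sub_self]
    · simp
    · exact Submodule.smul_mem _ _ (Submodule.smul_mem _ _ (Submodule.mem_span_singleton_self x))
  have h2 := congrArg conjTranspose (hT P hP hP' h1)
  rw [conjTranspose_corner hP', conjTranspose_zero] at h2
  have h3 := toEuclideanCLM_corner_apply (T := Tᴴ) hPK x
  rw [h2, Submodule.starProjection_eq_self_iff.2 (Submodule.mem_span_singleton_self x)] at h3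
  have h4 := Submodule.starProjection_eq_self_iff.1 (sub_eq_zero.1 (h3.symm.trans (by simp))).symm
  obtain ⟨c, hc⟩ := Submodule.mem_span_singleton.1 h4
  have h5 : inner ℂ (toEuclideanCLM (𝕜 := ℂ) Tᴴ x) x = inner ℂ x (toEuclideanCLM (𝕜 := ℂ) T x) := by
    rw [toEuclideanCLM_conjTranspose, ContinuousLinearMap.adjoint_inner_left]
  rw [← hc, hx, inner_smul_left, inner_smul_right] at h5
  have h6 := mul_right_cancel₀ (inner_self_ne_zero.2 hx0) h5
  rw [← hc, ← h6]
  simp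

lemma iSup_eigenspace_eq_top {E : Type*} [NormedAddCommGroup E] [InnerProductSpace ℂ E]
    [FiniteDimensional ℂ E] {f : E →ₗ[ℂ] E}
    (hf : ∀ (x) (μ : ℂ), f x = μ • x → LinearMap.adjoint f x = star μ • x) :
    ⨆ μ, Module.End.eigenspace f μ = ⊤ := by
  set W := ⨆ μ, Module.End.eigenspace f μ with hW
  have hadj : ∀ w ∈ W, LinearMap.adjoint f w ∈ W := by
    change W ≤ W.comap (LinearMap.adjoint f)
    refine iSup_le fun μ x hx => ?_
    rw [Submodule.mem_comap, hf x μ (Module.End.mem_eigenspace_iff.1 hx)]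
    exact Submodule.smul_mem _ _ (Submodule.mem_iSup_of_mem μ hx)
  rw [← Submodule.orthogonal_eq_bot_iff]
  by_contra hne
  have hinv : ∀ v ∈ Wᗮ, f v ∈ Wᗮ := by
    intro v hv w hw
    rw [← LinearMap.adjoint_inner_left]
    exact hv _ (hadj w hw)
  have := Submodule.nontrivial_iff_ne_bot.2 hne
  obtain ⟨μ, hμ⟩ := Module.End.exists_eigenvalue (f.restrict hinv)
  obtain ⟨⟨v, hv⟩, hvμ⟩ := hμ.exists_hasEigenvector
  have hfv : f v = μ • v := congrArg Subtype.val hvμ.apply_eq_smul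
  have hvW : v ∈ W := Submodule.mem_iSup_of_mem μ (Module.End.mem_eigenspace_iff.2 hfv)
  exact hvμ.2 (Subtype.ext (inner_self_eq_zero.1 (hv v hvW)))

/-- Matrices agreeing on the eigenvectors of a diagonalizable matrix are equal. -/
lemma matrix_ext_of_eigenvectors {n : ℕ} {T A B : Matrix (Fin n) (Fin n) ℂ}
    (htop : ⨆ μ, Module.End.eigenspace (toEuclideanLin T) μ = ⊤)
    (h : ∀ (x) (μ : ℂ), toEuclideanCLM (𝕜 := ℂ) T x = μ • x →
      toEuclideanCLM (𝕜 := ℂ) A x = toEuclideanCLM (𝕜 := ℂ) B x) : A = B := by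
  apply (EquivLike.injective (toEuclideanCLM (n := Fin n) (𝕜 := ℂ)))
  ext1 v
  have hv : v ∈ ⨆ μ, Module.End.eigenspace (toEuclideanLin T) μ := htop ▸ Submodule.mem_top
  induction hv using Submodule.iSup_induction' with
  | mem μ x hx => exact h x μ (Module.End.mem_eigenspace_iff.1 hx)
  | zero => simp
  | add x y _ _ hx hy => rw [map_add, map_add, hx, hy]

lemma exists_relation {n : ℕ} {T : Matrix (Fin n) (Fin n) ℂ}
    (htop : ⨆ μ, Module.End.eigenspace (toEuclideanLin T) μ = ⊤)
    (hadj : ∀ (x) (μ : ℂ), toEuclideanCLM (𝕜 := ℂ) T x = μ • x →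
      toEuclideanCLM (𝕜 := ℂ) Tᴴ x = star μ • x)
    (hrank : ∀ P : Matrix (Fin n) (Fin n) ℂ, P * P = P → Pᴴ = P →
      ((1 - P) * T * P).rank ≤ 1 → (P * T * (1 - P)).rank ≤ 1) :
    ∃ a b c d : ℂ, (a ≠ 0 ∨ b ≠ 0) ∧ a • (Tᴴ * T) + b • Tᴴ = c • T + d • 1 := by
  classical
  have hev : ∀ μ : Module.End.Eigenvalues (toEuclideanLin T),
      ∃ v, Module.End.HasEigenvector (toEuclideanLin T) (μ : ℂ) v :=
    fun μ => Module.End.HasEigenvalue.exists_hasEigenvector μ.2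
  choose e he using hev
  have hli : LinearIndependent ℂ e :=
    Module.End.eigenvectors_linearIndependent' _ _ Subtype.val_injective _ he
  set S := toEuclideanCLM (𝕜 := ℂ) T with hS
  set S' := toEuclideanCLM (𝕜 := ℂ) Tᴴ with hS'
  have hSe : ∀ μ, S (e μ) = (μ : ℂ) • e μ := fun μ => (he μ).apply_eq_smul
  have hSe' : ∀ μ, S' (e μ) = star (μ : ℂ) • e μ := fun μ => hadj _ _ (hSe μ)
  set x := ∑ μ, e μ with hx
  set K := Submodule.span ℂ {x, S x} with hK
  have hxK : x ∈ K := Submodule.subset_span (by simp)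
  have hSxK : S x ∈ K := Submodule.subset_span (by simp)
  obtain ⟨P, hP, hP', hPK⟩ := exists_projection_matrix K
  have hr1 : ((1 - P) * T * P).rank ≤ 1 := by
    refine rank_le_one_iff_exists_smul.2 ⟨S (S x) - K.starProjection (S (S x)), fun v => ?_⟩
    obtain ⟨c, d, hcd⟩ := Submodule.mem_span_pair.1 (K.starProjection_apply_mem v)
    refine ⟨d, ?_⟩
    rw [toEuclideanCLM_corner_apply hPK, ← hcd, ← hS, map_add, map_add, map_smul, map_smul, map_smul,
      map_smul, Submodule.starProjection_eq_self_iff.2 hSxK]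
    module
  have hr2 : ((1 - P) * Tᴴ * P).rank ≤ 1 := by
    rw [← conjTranspose_corner hP', rank_conjTranspose]
    exact hrank P hP hP' hr1
  obtain ⟨y, hy⟩ := rank_le_one_iff_exists_smul.1 hr2
  obtain ⟨a, ha⟩ := hy x
  obtain ⟨b, hb⟩ := hy (S x)
  rw [toEuclideanCLM_corner_apply hPK, Submodule.starProjection_eq_self_iff.2 hxK, ← hS'] at ha
  rw [toEuclideanCLM_corner_apply hPK, Submodule.starProjection_eq_self_iff.2 hSxK, ← hS'] at hb
  obtain ⟨p, q, hpq, h0⟩ : ∃ p q : ℂ, (p ≠ 0 ∨ q ≠ 0) ∧ p * b + q * a = 0 := by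
    by_cases h : a = 0
    · exact ⟨0, 1, by simp, by simp [h]⟩
    · exact ⟨a, -b, Or.inl h, by ring⟩
  have hmem : p • S' (S x) + q • S' x ∈ K := by
    rw [← Submodule.starProjection_eq_self_iff, map_add, map_smul, map_smul, ← sub_eq_zero]
    calc _ = -(p • (S' (S x) - K.starProjection (S' (S x))) +
            q • (S' x - K.starProjection (S' x))) := by module
      _ = -((p * b + q * a) • y) := by rw [← ha, ← hb]; module
      _ = 0 := by rw [h0]; simp
  obtain ⟨d, c, hcd⟩ := Submodule.mem_span_pair.1 hmem
  refine ⟨p, q, c, d, hpq, matrix_ext_of_eigenvectors htop fun v μ hv => ?_⟩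
  rcases eq_or_ne v 0 with rfl | hv0
  · simp
  have hμ : p * (star μ * μ) + q * star μ = c * μ + d := by
    have hμe : Module.End.HasEigenvalue (toEuclideanLin T) μ :=
      Module.End.hasEigenvalue_of_hasEigenvector ⟨Module.End.mem_eigenspace_iff.2 hv, hv0⟩
    have hsum : ∑ ν : Module.End.Eigenvalues (toEuclideanLin T), (p * (star (ν : ℂ) * ν) + q * star (ν : ℂ) - (c * ν + d)) •
        e ν = 0 := by
      have h := sub_eq_zero.2 hcd.symm
      simp only [hx, map_sum, hSe, hSe', map_smul, Finset.smul_sum, ← Finset.sum_add_distrib,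
        ← Finset.sum_sub_distrib] at h
      rw [← h]
      refine Finset.sum_congr rfl fun ν _ => ?_
      module
    exact sub_eq_zero.1 (Fintype.linearIndependent_iff.1 hli _ hsum ⟨μ, hμe⟩)
  have hv' := hadj v μ hv
  simp only [map_add, map_smul, map_mul, map_one, _root_.add_apply,
    _root_.smul_apply, mul_apply_eq_comp, one_apply_eq_self]
  rw [← hS, ← hS', hv, map_smul, hv', ← sub_eq_zero]
  calc _ = (p * (star μ * μ) + q * star μ - (c * μ + d)) • v := by module
    _ = 0 := by rw [hμ]; simp

lemma isAffineUnitaryOrHermitian_of_corners {n : ℕ} {T : Matrix (Fin n) (Fin n) ℂ}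
    (hzero : ∀ P : Matrix (Fin n) (Fin n) ℂ, P * P = P → Pᴴ = P →
      (1 - P) * T * P = 0 → P * T * (1 - P) = 0)
    (hrank : Tᴴ * T = T * Tᴴ → ∀ P : Matrix (Fin n) (Fin n) ℂ, P * P = P → Pᴴ = P →
      ((1 - P) * T * P).rank ≤ 1 → (P * T * (1 - P)).rank ≤ 1) :
    IsAffineUnitaryOrHermitian T := by
  have hadj : ∀ (x) (μ : ℂ), toEuclideanCLM (𝕜 := ℂ) T x = μ • x →
      toEuclideanCLM (𝕜 := ℂ) Tᴴ x = star μ • x := fun x μ => adjoint_apply_eigenvector hzero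
  have htop : ⨆ μ, Module.End.eigenspace (toEuclideanLin T) μ = ⊤ := by
    refine iSup_eigenspace_eq_top fun x μ hx => ?_
    rw [← toEuclideanLin_conjTranspose_eq_adjoint]
    exact hadj x μ hx
  have hnormal : Tᴴ * T = T * Tᴴ := by
    refine matrix_ext_of_eigenvectors htop fun x μ hx => ?_
    simp only [map_mul, mul_apply_eq_comp]
    rw [hx, hadj x μ hx, map_smul, map_smul, hx, hadj x μ hx, smul_comm]
  obtain ⟨a, b, c, d, hab, h⟩ := exists_relation htop hadj (hrank hnormal)
  exact isAffineUnitaryOrHermitian_of_relation hab h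

lemma HasCN.isAffineUnitaryOrHermitian {n : ℕ} {T : Matrix (Fin n) (Fin n) ℂ} (h : HasCN T) :
    IsAffineUnitaryOrHermitian T := by
  refine isAffineUnitaryOrHermitian_of_corners (fun P hP hP' h0 => ?_)
    fun hT P hP hP' => (rank_corner_le_one_iff_of_normal hT hP hP' (h P hP hP')).2
  rw [← opN_eq_zero_iff, h P hP hP', h0, opN_eq_zero_iff]

lemma HasCR.isAffineUnitaryOrHermitian {n : ℕ} {T : Matrix (Fin n) (Fin n) ℂ} (h : HasCR T) :
    IsAffineUnitaryOrHermitian T := by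
  refine isAffineUnitaryOrHermitian_of_corners (fun P hP hP' h0 => ?_)
    fun _ P hP hP' => (h P hP hP').le.trans
  have h1 := h P hP hP'
  rw [h0, rank_zero] at h1
  rw [rank, Submodule.finrank_eq_zero, LinearMap.range_eq_bot] at h1
  exact ext_of_mulVec_single fun i =>
    (LinearMap.congr_fun h1 (Pi.single i 1)).trans (zero_mulVec _).symm

end Corners

theorem stmt9 {n : ℕ} (hn : 4 ≤ n) (T : Matrix (Fin n) (Fin n) ℂ) :
    (HasCN T ↔ HasCR T) ∧
    (HasCN T ↔
      ((∃ (fl mu : ℂ) (V : Matrix (Fin n) (Fin n) ℂ), Vᴴ * V = 1 ∧ T = fl • 1 + mu • V) ∨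
       (∃ (fl mu : ℂ) (L : Matrix (Fin n) (Fin n) ℂ), Lᴴ = L ∧ T = fl • 1 + mu • L))) := by
  exact ⟨⟨fun h => h.isAffineUnitaryOrHermitian.corners.2,
      fun h => h.isAffineUnitaryOrHermitian.corners.1⟩,
    fun h => h.isAffineUnitaryOrHermitian, fun h => (IsAffineUnitaryOrHermitian.corners h).1⟩
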